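/- arXiv:0810.1382 — 2 statements merged into one kernel-verified Lean document; each statement's English description precedes it below -/
import Mathlib

section
/- For each k ∈ {3,…,9}, let I_k ⊆ ℂ[u,v] be the ideal generated by all monomials u^a v^b (a,b ∈ ℕ) satisfying 4a + 25b ≥ 10k − 28. Then I_3 = (u, v), I_4 = (u³, v), I_5 = (u⁶, v), I_6 = (u⁸, u²v, v²), I_7 = (u¹¹, u⁵v, v²), I_8 = (u¹³, u⁷v, uv², v³), I_9 = (u¹⁶, u¹⁰v, u³v², v³), and the ℂ-dimension of ℂ[u,v]/I_k for k = 3,…,9 equals 1, 3, 6, 10, 16, 21, 29 respectively. -/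
open MvPolynomial

noncomputable def u : MvPolynomial (Fin 2) ℂ := MvPolynomial.X 0
noncomputable def v : MvPolynomial (Fin 2) ℂ := MvPolynomial.X 1

/-- The monomial ideal given by the criterion of Lemma 2 for the singularity
`B_{25,4}` (weight vector `Q = (4,25)`, degree `d = 10`). -/
noncomputable def I₂₅₄ (k : ℕ) : Ideal (MvPolynomial (Fin 2) ℂ) :=
  Ideal.span {m | ∃ a b : ℕ, m = u ^ a * v ^ b ∧
    (4 * a + 25 * b : ℤ) ≥ 10 * (k : ℤ) - 28}

/-- The monomials outside an upper set `s` of exponents form a basis of the quotient by the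
monomial ideal of `s`. -/
theorem finrank_quotient_span_monomial {σ K : Type*} [Field K] {s : Set (σ →₀ ℕ)}
    (hs : IsUpperSet s) :
    Module.finrank K (MvPolynomial σ K ⧸
      Ideal.span ((fun e => monomial e (1 : K)) '' s)) = Nat.card ↥(sᶜ) := by
  let φ : MvPolynomial σ K →ₗ[K] (↥(sᶜ) →₀ K) :=
    Finsupp.lcomapDomain (R := K) (M := K) ((↑) : ↥(sᶜ) → σ →₀ ℕ) Subtype.val_injective ∘ₗ
      (AddMonoidAlgebra.coeffLinearEquiv K).toLinearMap
  have hφ : ∀ p e, φ p e = coeff e.1 p := fun _ _ => rfl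
  have hker : LinearMap.ker φ =
      (Ideal.span ((fun e => monomial e (1 : K)) '' s)).restrictScalars K := by
    ext p
    rw [LinearMap.mem_ker, Submodule.restrictScalars_mem, mem_ideal_span_monomial_image]
    constructor
    · intro h e he
      by_contra! hlt
      have hes : e ∈ sᶜ := fun hmem => hlt e hmem le_rfl
      exact mem_support_iff.1 he (by simpa [hφ] using DFunLike.congr_fun h ⟨e, hes⟩)
    · intro h
      ext e
      rw [hφ]
      by_contra hne
      obtain ⟨f, hf, hle⟩ := h e (mem_support_iff.2 hne)
      exact e.2 (hs hle hf)
  have hsurj : Function.Surjective φ := fun f =>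
    ⟨AddMonoidAlgebra.ofCoeff (f.mapDomain (↑)), by
      ext e
      exact Finsupp.mapDomain_apply Subtype.val_injective f e⟩
  have e₁ := (Submodule.Quotient.restrictScalarsEquiv K
    (Ideal.span ((fun e => monomial e (1 : K)) '' s))).symm.finrank_eq
  rw [e₁, ← hker, (φ.quotKerEquivOfSurjective hsurj).finrank_eq,
    Module.finrank_eq_nat_card_basis Finsupp.basisSingleOne]

theorem u_pow_mul_v_pow_eq_monomial (e : Fin 2 →₀ ℕ) :
    u ^ e 0 * v ^ e 1 = monomial e 1 := by
  rw [monomial_eq, Finsupp.prod_fintype _ _ (by simp)]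
  simp [u, v]

theorem adjunction_ideal_eq_span_monomial (k : ℕ) :
    I₂₅₄ k = Ideal.span ((fun e => monomial e (1 : ℂ)) ''
      {e : Fin 2 →₀ ℕ | 10 * k ≤ 4 * e 0 + 25 * e 1 + 28}) := by
  rw [I₂₅₄]
  congr 1
  ext m
  constructor
  · rintro ⟨a, b, rfl, h⟩
    refine ⟨Finsupp.equivFunOnFinite.symm ![a, b], ?_, ?_⟩
    · simp only [Set.mem_ofPred_eq, Finsupp.equivFunOnFinite_symm_apply_apply,
        Matrix.cons_val_zero, Matrix.cons_val_one]
      omega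
    · simp [← u_pow_mul_v_pow_eq_monomial]
  · rintro ⟨e, he, rfl⟩
    simp only [Set.mem_ofPred_eq] at he
    exact ⟨e 0, e 1, (u_pow_mul_v_pow_eq_monomial e).symm, by omega⟩

theorem finrank_quotient_adjunction_ideal (k : ℕ) :
    Module.finrank ℂ (MvPolynomial (Fin 2) ℂ ⧸ I₂₅₄ k) =
      ((Finset.range (3 * k) ×ˢ Finset.range k).filter
        fun p => 4 * p.1 + 25 * p.2 + 28 < 10 * k).card := by
  rw [adjunction_ideal_eq_span_monomial, finrank_quotient_span_monomial]
  · rw [← Nat.card_eq_finsetCard]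
    refine Nat.card_congr ((Finsupp.equivFunOnFinite.trans
      (finTwoArrowEquiv ℕ)).subtypeEquiv fun e => ?_)
    change ¬ 10 * k ≤ 4 * e 0 + 25 * e 1 + 28 ↔ (e 0, e 1) ∈ _
    simp only [Finset.mem_filter, Finset.mem_product, Finset.mem_range]
    omega
  · intro e f hef he
    have h₀ := hef 0
    have h₁ := hef 1
    simp only [Set.mem_ofPred_eq] at he ⊢
    omega

/-- A set `G` of exponents satisfying the weight condition, such that every exponent satisfying it
dominates an element of `G`, generates the adjunction ideal. -/
theorem adjunction_ideal_eq_span {k : ℕ} (G : Set (ℕ × ℕ))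
    (hG : ∀ g ∈ G, 10 * k ≤ 4 * g.1 + 25 * g.2 + 28)
    (hdom : ∀ a b : ℕ, 10 * k ≤ 4 * a + 25 * b + 28 → ∃ g ∈ G, g.1 ≤ a ∧ g.2 ≤ b) :
    I₂₅₄ k = Ideal.span ((fun g => u ^ g.1 * v ^ g.2) '' G) := by
  apply le_antisymm
  · rw [I₂₅₄, Ideal.span_le]
    rintro _ ⟨a, b, rfl, h⟩
    obtain ⟨g, hg, ha, hb⟩ := hdom a b (by omega)
    exact Ideal.mem_of_dvd _ (mul_dvd_mul (pow_dvd_pow u ha) (pow_dvd_pow v hb))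
      (Ideal.subset_span ⟨g, hg, rfl⟩)
  · rw [Ideal.span_le]
    rintro _ ⟨g, hg, rfl⟩
    have := hG g hg
    exact Ideal.subset_span ⟨g.1, g.2, rfl, by omega⟩

theorem adjunction_ideals_B254 :
    I₂₅₄ 3 = Ideal.span {u, v} ∧
    I₂₅₄ 4 = Ideal.span {u ^ 3, v} ∧
    I₂₅₄ 5 = Ideal.span {u ^ 6, v} ∧
    I₂₅₄ 6 = Ideal.span {u ^ 8, u ^ 2 * v, v ^ 2} ∧
    I₂₅₄ 7 = Ideal.span {u ^ 11, u ^ 5 * v, v ^ 2} ∧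
    I₂₅₄ 8 = Ideal.span {u ^ 13, u ^ 7 * v, u * v ^ 2, v ^ 3} ∧
    I₂₅₄ 9 = Ideal.span {u ^ 16, u ^ 10 * v, u ^ 3 * v ^ 2, v ^ 3} ∧
    Module.finrank ℂ (MvPolynomial (Fin 2) ℂ ⧸ I₂₅₄ 3) = 1 ∧
    Module.finrank ℂ (MvPolynomial (Fin 2) ℂ ⧸ I₂₅₄ 4) = 3 ∧
    Module.finrank ℂ (MvPolynomial (Fin 2) ℂ ⧸ I₂₅₄ 5) = 6 ∧
    Module.finrank ℂ (MvPolynomial (Fin 2) ℂ ⧸ I₂₅₄ 6) = 10 ∧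
    Module.finrank ℂ (MvPolynomial (Fin 2) ℂ ⧸ I₂₅₄ 7) = 16 ∧
    Module.finrank ℂ (MvPolynomial (Fin 2) ℂ ⧸ I₂₅₄ 8) = 21 ∧
    Module.finrank ℂ (MvPolynomial (Fin 2) ℂ ⧸ I₂₅₄ 9) = 29 := by
  refine ⟨?_, ?_, ?_, ?_, ?_, ?_, ?_, ?_, ?_, ?_, ?_, ?_, ?_, ?_⟩
  · simpa [Set.image_insert_eq] using adjunction_ideal_eq_span {(1, 0), (0, 1)}
      (by simp) (by simp; omega)
  · simpa [Set.image_insert_eq] using adjunction_ideal_eq_span {(3, 0), (0, 1)}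
      (by simp) (by simp; omega)
  · simpa [Set.image_insert_eq] using adjunction_ideal_eq_span {(6, 0), (0, 1)}
      (by simp) (by simp; omega)
  · simpa [Set.image_insert_eq] using adjunction_ideal_eq_span {(8, 0), (2, 1), (0, 2)}
      (by simp) (by simp; omega)
  · simpa [Set.image_insert_eq] using adjunction_ideal_eq_span {(11, 0), (5, 1), (0, 2)}
      (by simp) (by simp; omega)
  · simpa [Set.image_insert_eq] using adjunction_ideal_eq_span {(13, 0), (7, 1), (1, 2), (0, 3)}
      (by simp) (by simp; omega)
  · simpa [Set.image_insert_eq] using adjunction_ideal_eq_span {(16, 0), (10, 1), (3, 2), (0, 3)}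
      (by simp) (by simp; omega)
  all_goals
    rw [finrank_quotient_adjunction_ideal]
    simp only [Finset.card_filter, Finset.sum_product, Finset.sum_range_succ, Finset.sum_range_zero]
    norm_num
end

section
/- Let f = u²⁰ + v⁵ in the formal power series ring ℂ⟦u,v⟧, and for k ∈ {3,…,9} let I_k ⊆ ℂ⟦u,v⟧ be the ideal generated by all monomials u^a v^b with a + 4b ≥ 2k − 4. Then for every nonzero g ∈ I_k, the ℂ-dimension of ℂ⟦u,v⟧/(f, g) is strictly greater than 10(k − 3). -/
/-- `u` in `ℂ⟦u,v⟧`. -/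
noncomputable def U : MvPowerSeries (Fin 2) ℂ := MvPowerSeries.X 0
/-- `v` in `ℂ⟦u,v⟧`. -/
noncomputable def V : MvPowerSeries (Fin 2) ℂ := MvPowerSeries.X 1

/-- The adjunction ideal `J_{O,k,10}` of the singularity `B_{20,5}`. -/
noncomputable def J₂₀₅ (k : ℕ) : Ideal (MvPowerSeries (Fin 2) ℂ) :=
  Ideal.span {m | ∃ a b : ℕ, m = U ^ a * V ^ b ∧
    (a + 4 * b : ℤ) ≥ 2 * (k : ℤ) - 4}

/-- The exponent vector of the monomial `u ^ a * v ^ b`. -/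
noncomputable def expo (a b : ℕ) : Fin 2 →₀ ℕ := Finsupp.single 0 a + Finsupp.single 1 b

lemma expo_zero (a b : ℕ) : expo a b 0 = a := by simp [expo]

lemma expo_one (a b : ℕ) : expo a b 1 = b := by simp [expo]

lemma expo_eta (m : Fin 2 →₀ ℕ) : expo (m 0) (m 1) = m := by
  ext i
  fin_cases i
  · exact expo_zero _ _
  · exact expo_one _ _

/-- The series all of whose monomials `u ^ a * v ^ b` have weight `a + 4 * b ≥ d`. -/
def weightFiltration (d : ℕ) : Submodule ℂ (MvPowerSeries (Fin 2) ℂ) where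
  carrier := {h | ∀ m : Fin 2 →₀ ℕ, m 0 + 4 * m 1 < d → MvPowerSeries.coeff m h = 0}
  zero_mem' := by simp
  add_mem' {x y} hx hy m hm := by simp [hx m hm, hy m hm]
  smul_mem' c x hx m hm := by simp [hx m hm]

lemma mem_weightFiltration {d : ℕ} {h : MvPowerSeries (Fin 2) ℂ} :
    h ∈ weightFiltration d ↔
      ∀ m : Fin 2 →₀ ℕ, m 0 + 4 * m 1 < d → MvPowerSeries.coeff m h = 0 :=
  Iff.rfl

lemma mul_mem_weightFiltration {p q : ℕ} {x y : MvPowerSeries (Fin 2) ℂ}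
    (hx : x ∈ weightFiltration p) (hy : y ∈ weightFiltration q) :
    x * y ∈ weightFiltration (p + q) := by
  classical
  intro m hm
  rw [MvPowerSeries.coeff_mul]
  refine Finset.sum_eq_zero fun ij hij => ?_
  rw [Finset.HasAntidiagonal.mem_antidiagonal] at hij
  subst hij
  simp only [Finsupp.add_apply] at hm
  by_cases h : ij.1 0 + 4 * ij.1 1 < p
  · rw [hx _ h, zero_mul]
  · rw [hy ij.2 (by omega), mul_zero]

lemma U_pow_mul_V_pow (a b : ℕ) : U ^ a * V ^ b = MvPowerSeries.monomial (expo a b) (1 : ℂ) := by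
  rw [U, V, MvPowerSeries.X_pow_eq, MvPowerSeries.X_pow_eq, MvPowerSeries.monomial_mul_monomial,
    one_mul, expo]

lemma mem_weightFiltration_of_mem_J₂₀₅ {k : ℕ} {g : MvPowerSeries (Fin 2) ℂ} (hg : g ∈ J₂₀₅ k) :
    g ∈ weightFiltration (2 * k - 4) := by
  classical
  refine Submodule.span_induction ?_ (zero_mem _) (fun _ _ _ _ => add_mem) ?_ hg
  · rintro _ ⟨a, b, rfl, hab⟩ m hm
    rw [U_pow_mul_V_pow, MvPowerSeries.coeff_monomial, if_neg]
    rintro rfl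
    rw [expo_zero, expo_one] at hm
    omega
  · intro r x _ hx
    have hr : r ∈ weightFiltration 0 := fun m hm => absurd hm (Nat.not_lt_zero _)
    simpa using mul_mem_weightFiltration hr hx

/-- For `a < 40` and `b < 5`, the coefficient of `u ^ a * v ^ b` in the remainder of a series on
division by `u ^ 20 + v ^ 5` with respect to `v`. -/
noncomputable def remainderCoeff (a b : ℕ) : MvPowerSeries (Fin 2) ℂ →ₗ[ℂ] ℂ :=
  MvPowerSeries.coeff (expo a b) -
    if 20 ≤ a then MvPowerSeries.coeff (expo (a - 20) (b + 5)) else 0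

lemma coeff_U_pow_mul (a b i : ℕ) (h : MvPowerSeries (Fin 2) ℂ) :
    MvPowerSeries.coeff (expo a b) (U ^ i * h) =
      if i ≤ a then MvPowerSeries.coeff (expo (a - i) b) h else 0 := by
  classical
  have e : expo i 0 ≤ expo a b ↔ i ≤ a := by
    simp [Finsupp.le_def, Fin.forall_fin_two, expo_zero, expo_one]
  have s : expo a b - expo i 0 = expo (a - i) b := by
    ext j; fin_cases j <;> simp [expo]
  have := U_pow_mul_V_pow i 0
  rw [pow_zero, mul_one] at this
  rw [this, MvPowerSeries.coeff_monomial_mul, s, one_mul]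
  simp only [e]

lemma coeff_V_pow_mul (a b i : ℕ) (h : MvPowerSeries (Fin 2) ℂ) :
    MvPowerSeries.coeff (expo a b) (V ^ i * h) =
      if i ≤ b then MvPowerSeries.coeff (expo a (b - i)) h else 0 := by
  classical
  have e : expo 0 i ≤ expo a b ↔ i ≤ b := by
    simp [Finsupp.le_def, Fin.forall_fin_two, expo_zero, expo_one]
  have s : expo a b - expo 0 i = expo a (b - i) := by
    ext j; fin_cases j <;> simp [expo]
  have := U_pow_mul_V_pow 0 i
  rw [pow_zero, one_mul] at this
  rw [this, MvPowerSeries.coeff_monomial_mul, s, one_mul]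
  simp only [e]

lemma remainderCoeff_mul {a b : ℕ} (ha : a < 40) (hb : b < 5) (q : MvPowerSeries (Fin 2) ℂ) :
    remainderCoeff a b ((U ^ 20 + V ^ 5) * q) = 0 := by
  have hb' : ¬ 5 ≤ b := by omega
  have ha' : ¬ 20 ≤ a - 20 := by omega
  by_cases h : 20 ≤ a <;>
    simp [remainderCoeff, add_mul, coeff_U_pow_mul, coeff_V_pow_mul, h, hb', ha']

lemma remainderCoeff_eq_zero {a b n : ℕ} (hab : a + 4 * b < n) {h : MvPowerSeries (Fin 2) ℂ}
    (hh : h ∈ weightFiltration n) : remainderCoeff a b h = 0 := by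
  have h₁ := hh (expo a b) (by rwa [expo_zero, expo_one])
  by_cases h20 : 20 ≤ a
  · have h₂ := hh (expo (a - 20) (b + 5)) (by rw [expo_zero, expo_one]; omega)
    simp [remainderCoeff, h20, h₁, h₂]
  · simp [remainderCoeff, h20, h₁]

/-- The coefficients of weight less than `n` of the remainder on division by `u ^ 20 + v ^ 5`. -/
noncomputable def remainderMap (n : ℕ) :
    MvPowerSeries (Fin 2) ℂ →ₗ[ℂ] ((Σ b : Fin 5, Fin (n - 4 * b)) → ℂ) :=
  LinearMap.pi fun p => remainderCoeff p.2 p.1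

lemma remainderMap_surjective (n : ℕ) : Function.Surjective (remainderMap n) := by
  intro w
  let c : ℕ → ℕ → ℂ := fun a b =>
    if hb : b < 5 then if ha : a < n - 4 * b then w ⟨⟨b, hb⟩, ⟨a, ha⟩⟩ else 0 else 0
  let h : MvPowerSeries (Fin 2) ℂ := fun m => c (m 0) (m 1)
  have hc (a b : ℕ) : MvPowerSeries.coeff (expo a b) h = c a b := by
    change c (expo a b 0) (expo a b 1) = c a b
    rw [expo_zero, expo_one]
  refine ⟨h, funext ?_⟩
  rintro ⟨⟨b, hb⟩, ⟨a, ha⟩⟩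
  have h₁ : c a b = w ⟨⟨b, hb⟩, ⟨a, ha⟩⟩ := by
    simp only [c, dif_pos hb]
    exact dif_pos ha
  have h₂ : c (a - 20) (b + 5) = 0 := dif_neg (by omega)
  by_cases h20 : 20 ≤ a <;> simp [remainderMap, remainderCoeff, h20, hc, h₁, h₂]

/-- The coefficients of weight less than `16`. -/
noncomputable def lowCoeffs :
    MvPowerSeries (Fin 2) ℂ →ₗ[ℂ] ((Σ b : Fin 4, Fin (16 - 4 * b)) → ℂ) :=
  LinearMap.pi fun p => MvPowerSeries.coeff (expo p.2 p.1)

lemma ker_lowCoeffs_le : LinearMap.ker lowCoeffs ≤ weightFiltration 16 := by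
  intro h hh m hm
  have := congrFun (LinearMap.mem_ker.mp hh) ⟨⟨m 1, by omega⟩, ⟨m 0, by simp only; omega⟩⟩
  simpa [lowCoeffs, expo_eta] using this

/-- If `ker A ≤ ker L`, then the range of `L` is no larger than the target of `A`. -/
lemma finrank_range_le_of_ker_le {K E F G : Type*} [Field K] [AddCommGroup E] [Module K E]
    [AddCommGroup F] [Module K F] [AddCommGroup G] [Module K G] [FiniteDimensional K F]
    (A : E →ₗ[K] F) (L : E →ₗ[K] G) (h : LinearMap.ker A ≤ LinearMap.ker L) :
    Module.finrank K (LinearMap.range L) ≤ Module.finrank K F := by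
  obtain ⟨B, rfl⟩ := (LinearMap.exists_extend
    ((LinearMap.ker A).liftQ L h ∘ₗ A.quotKerEquivRange.symm.toLinearMap)).imp fun B hB =>
      (show B ∘ₗ A = L by
        ext x
        have := LinearMap.congr_fun hB ⟨A x, LinearMap.mem_range_self A x⟩
        have hx : A.quotKerEquivRange.symm ⟨A x, LinearMap.mem_range_self A x⟩ =
            (LinearMap.ker A).mkQ x := A.quotKerEquivRange_symm_apply_image x _
        simpa [hx] using this)
  have h₁ := Submodule.finrank_mono (LinearMap.range_comp_le_range A B)
  exact h₁.trans (LinearMap.finrank_range_le B)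

/-- For `f = u²⁰ + v⁵` and any nonzero `g` in the adjunction ideal
`J_{O,k,10}`, `3 ≤ k ≤ 9`, the intersection number `dim_ℂ ℂ⟦u,v⟧/(f,g)` is
strictly greater than `10(k-3)`. -/
theorem iota_B205 (k : ℕ) (hk3 : 3 ≤ k) (hk9 : k ≤ 9)
    (g : MvPowerSeries (Fin 2) ℂ) (hg : g ∈ J₂₀₅ k) (hg0 : g ≠ 0) :
    ((10 * (k - 3) : ℕ) : Cardinal) <
      Module.rank ℂ
        (MvPowerSeries (Fin 2) ℂ ⧸ Ideal.span {U ^ 20 + V ^ 5, g}) := by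
  have hgd := mem_weightFiltration_of_mem_J₂₀₅ hg
  let φ := remainderMap (16 + (2 * k - 4))
  let L := φ ∘ₗ LinearMap.mulRight ℂ g
  have hL : LinearMap.ker lowCoeffs ≤ LinearMap.ker L := fun h hh => by
    refine LinearMap.mem_ker.mpr (funext fun p => ?_)
    exact remainderCoeff_eq_zero (by have := p.2.2; omega)
      (mul_mem_weightFiltration (ker_lowCoeffs_le hh) hgd)
  have hrange := finrank_range_le_of_ker_le lowCoeffs L hL
  let ψ := (LinearMap.range L).mkQ ∘ₗ φ
  have hψ : (Ideal.span {U ^ 20 + V ^ 5, g}).restrictScalars ℂ ≤ LinearMap.ker ψ := by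
    intro x hx
    obtain ⟨q, r, rfl⟩ := Ideal.mem_span_pair.mp hx
    have hq : φ (q * (U ^ 20 + V ^ 5)) = 0 := funext fun p => by
      rw [mul_comm q]
      exact remainderCoeff_mul (by have := p.2.2; omega) p.1.2 q
    rw [LinearMap.mem_ker, LinearMap.comp_apply, map_add, hq, zero_add, Submodule.mkQ_apply,
      Submodule.Quotient.mk_eq_zero]
    exact ⟨r, rfl⟩
  have hsurj : Function.Surjective
      (((Ideal.span {U ^ 20 + V ^ 5, g}).restrictScalars ℂ).liftQ ψ hψ) := by
    intro y
    obtain ⟨x, rfl⟩ := ((LinearMap.range L).mkQ_surjective.comp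
      (remainderMap_surjective _)) y
    exact ⟨Submodule.Quotient.mk x, rfl⟩
  have hrank := LinearMap.rank_le_of_surjective _ hsurj
  rw [← Module.finrank_eq_rank] at hrank
  refine lt_of_lt_of_le (Nat.cast_lt.mpr ?_) hrank
  have hquot := (LinearMap.range L).finrank_quotient_add_finrank
  simp only [Module.finrank_fintype_fun_eq_card, Fintype.card_sigma, Fintype.card_fin,
    Fin.sum_univ_five, Fin.sum_univ_four] at hquot hrange
  norm_num at hquot hrange
  omega
end
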